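/- The element g = x_0 x_1² x_4 x_5² x_8 x_9² x_{12} x_{13}² x_{14}⁻¹ x_{12}⁻² x_{10}⁻¹ x_8⁻² x_6⁻¹ x_4⁻² x_2⁻¹ x_0⁻² of Thompson's group F has word length exactly 28 with respect to the generating set X_2 = {x_0, x_1, x_2}, i.e., l_2(g) = 28. -/

import Mathlib

/-- The defining relations of Thompson's group `F` in the infinite presentation
`⟨x_k, k ≥ 0 | x_i⁻¹ x_j x_i = x_{j+1} for i < j⟩`. -/
def thompsonRels : Set (FreeGroup ℕ) :=
  {w | ∃ i j : ℕ, i < j ∧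
    w = (FreeGroup.of i)⁻¹ * FreeGroup.of j * FreeGroup.of i * (FreeGroup.of (j + 1))⁻¹}

/-- Thompson's group `F`. -/
abbrev ThompsonF := PresentedGroup thompsonRels

/-- The standard infinite family of generators `x_i` of Thompson's group `F`. -/
def x (i : ℕ) : ThompsonF := PresentedGroup.of i

/-- The word length of `g` with respect to a generating set `S`:
the least `m` such that `g` is a product of `m` elements of `S ∪ S⁻¹`. -/
noncomputable def wordLength {G : Type*} [Group G] (S : Set G) (g : G) : ℕ :=
  sInf {m | ∃ l : List G, l.length = m ∧ (∀ a ∈ l, a ∈ S ∨ a⁻¹ ∈ S) ∧ l.prod = g}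

/-- The consecutive generating set `X_n = {x_0, x_1, …, x_n}`. -/
def Xset (n : ℕ) : Set ThompsonF := {g | ∃ i ≤ n, g = x i}

/-- `l_n(g)`: word length of `g` with respect to `X_n`. -/
noncomputable def ln (n : ℕ) (g : ThompsonF) : ℕ := wordLength (Xset n) g

/-- `l_∞(g)`: word length of `g` with respect to the infinite generating set `{x_i | i ≥ 0}`. -/
noncomputable def linf (g : ThompsonF) : ℕ := wordLength (Set.range x) g

/-- The word metric `d_n(g,h) = l_n(g⁻¹ h)`. -/
noncomputable def dn (n : ℕ) (g h : ThompsonF) : ℕ := ln n (g⁻¹ * h)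

/-- The piecewise linear homeomorphism representing `x i`: the identity on `(-∞, i]`,
of slope `1 / 2` on `[i, i + 2]` and translation by `-1` on `[i + 2, ∞)`. -/
def plPerm (i : ℕ) : Equiv.Perm ℚ where
  toFun t := min t (max ((t + i) / 2) (t - 1))
  invFun t := max t (min (2 * t - i) (t + 1))
  left_inv t := by grind
  right_inv t := by grind

theorem plPerm_mul {i j : ℕ} (h : i < j) : plPerm j * plPerm i = plPerm i * plPerm (j + 1) := by
  ext t
  have h' : (i : ℚ) + 1 ≤ j := by exact_mod_cast h
  simp only [plPerm, Equiv.Perm.mul_apply, Equiv.coe_fn_mk, Nat.cast_add, Nat.cast_one]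
  grind

/-- The action of Thompson's group `F` on `ℚ` by piecewise linear maps. -/
def plHom : ThompsonF →* Equiv.Perm ℚ :=
  PresentedGroup.toGroup (f := plPerm) (by
    rintro _ ⟨i, j, h, rfl⟩
    simp only [map_mul, map_inv, FreeGroup.lift_apply_of]
    rw [mul_inv_eq_one, mul_assoc, inv_mul_eq_iff_eq_mul, plPerm_mul h])

theorem plHom_x (i : ℕ) : plHom (x i) = plPerm i :=
  PresentedGroup.toGroup.of _

theorem plPerm_apply_of_le {i : ℕ} {t : ℚ} (h : t ≤ i) : plPerm i t = t := by
  simp only [plPerm, Equiv.coe_fn_mk]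
  grind

theorem plPerm_pow_apply_of_le {i : ℕ} {t : ℚ} (h : t ≤ i) (a : ℕ) : (plPerm i ^ a) t = t := by
  induction a with
  | zero => rfl
  | succ a ih => rw [pow_succ, Equiv.Perm.mul_apply, plPerm_apply_of_le h, ih]

theorem plPerm_pow_apply (i a : ℕ) : (plPerm i ^ a) (i + 1) = i + (1 / 2) ^ a := by
  induction a with
  | zero => simp
  | succ a ih =>
    have h₀ : (0 : ℚ) < (1 / 2) ^ a := by positivity
    have h₁ : ((1 : ℚ) / 2) ^ a ≤ 1 := pow_le_one₀ (by norm_num) (by norm_num)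
    rw [pow_succ', Equiv.Perm.mul_apply, ih, pow_succ]
    simp only [plPerm, Equiv.coe_fn_mk]
    grind

theorem x_mul_x {i j : ℕ} (h : i < j) : x j * x i = x i * x (j + 1) := by
  have := PresentedGroup.one_of_mem (rels := thompsonRels) ⟨i, j, h, rfl⟩
  simp only [map_mul, map_inv] at this
  rw [mul_inv_eq_one, mul_assoc, inv_mul_eq_iff_eq_mul] at this
  exact this

theorem x_mul_x_pow {i j : ℕ} (h : i < j) (b : ℕ) : x j * x i ^ b = x i ^ b * x (j + b) := by
  induction b with
  | zero => simp
  | succ b ih =>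
    rw [pow_succ, ← mul_assoc, ih, mul_assoc, x_mul_x (by omega), ← mul_assoc, add_assoc]

theorem x_pow_mul_x {i j : ℕ} (h : i < j) (b : ℕ) : x j ^ b * x i = x i * x (j + 1) ^ b := by
  have : (x i)⁻¹ * x j * x i = x (j + 1) := by rw [mul_assoc, x_mul_x h, inv_mul_cancel_left]
  rw [← this]
  simpa [mul_assoc] using congrArg (x i * ·) (conj_pow (a := (x i)⁻¹) (b := x j) (i := b)).symm

/-- The list `[(a₀, b₀), (a₁, b₁), …]` encodes the element
`x p ^ a₀ * x (p + 1) ^ a₁ * ⋯ * (x (p + 1) ^ b₁)⁻¹ * (x p ^ b₀)⁻¹`. -/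
def formVal : ℕ → List (ℕ × ℕ) → ThompsonF
  | _, [] => 1
  | p, (a, b) :: s => x p ^ a * formVal (p + 1) s * (x p ^ b)⁻¹

/-- The number of letters of the word encoded by a list of exponents. This and other functions
used in the search below are defined by the recursor, which the kernel evaluates faster. -/
def formSize (s : List (ℕ × ℕ)) : ℕ :=
  s.rec 0 fun e _ n => Nat.add (Nat.add e.1 e.2) n

theorem formSize_nil : formSize [] = 0 := rfl

theorem formSize_cons (a b : ℕ) (s : List (ℕ × ℕ)) :
    formSize ((a, b) :: s) = a + b + formSize s := rfl

/-- Whether the first pair of exponents vanishes; the empty list stands for zeros only. -/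
def headBlank : List (ℕ × ℕ) → Bool
  | [] => true
  | (a, b) :: _ => Nat.beq a 0 && Nat.beq b 0

/-- The normal form condition: if `x k` and `(x k)⁻¹` both occur, then so does
`x (k + 1)` or its inverse. -/
def IsReducedForm : List (ℕ × ℕ) → Prop
  | [] => True
  | (a, b) :: s => (a ≠ 0 → b ≠ 0 → headBlank s = false) ∧ IsReducedForm s

/-- The normal form of `g * x i`, from that of `g`. -/
def mulGen : List (ℕ × ℕ) → ℕ → List (ℕ × ℕ)
  | [], i => List.replicate i (0, 0) ++ [(1, 0)]
  | (a, 0) :: s, 0 => (a + 1, 0) :: (0, 0) :: s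
  | (a, b + 1) :: s, 0 => (a, b) :: s
  | (a, b) :: s, i + 1 => (a, b) :: mulGen s (i + b)

/-- The normal form of `g * (x i)⁻¹`, from that of `g`. -/
def mulInvGen : List (ℕ × ℕ) → ℕ → List (ℕ × ℕ)
  | [], i => List.replicate i (0, 0) ++ [(0, 1)]
  | (a, b) :: s, 0 =>
    bif Nat.blt 0 a && Nat.beq b 0 && headBlank s then (a - 1, 0) :: s.tail else (a, b + 1) :: s
  | (a, b) :: s, i + 1 => (a, b) :: mulInvGen s (i + b)

theorem formVal_mul_x (s : List (ℕ × ℕ)) {p q : ℕ} (h : q < p) :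
    formVal p s * x q = x q * formVal (p + 1) s := by
  induction s generalizing p with
  | nil => simp [formVal]
  | cons e s ih =>
    obtain ⟨a, b⟩ := e
    have hb : (x p ^ b)⁻¹ * x q = x q * (x (p + 1) ^ b)⁻¹ := by
      rw [inv_mul_eq_iff_eq_mul, ← mul_assoc, x_pow_mul_x h, mul_inv_cancel_right]
    simp only [formVal]
    rw [mul_assoc, hb, ← mul_assoc, mul_assoc (x p ^ a), ih (by omega), ← mul_assoc,
      x_pow_mul_x h]
    simp only [mul_assoc]

theorem formVal_replicate_append (p i : ℕ) (s : List (ℕ × ℕ)) :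
    formVal p (List.replicate i (0, 0) ++ s) = formVal (p + i) s := by
  induction i generalizing p with
  | zero => rfl
  | succ i ih =>
    simp only [List.replicate_succ, List.cons_append, formVal, ih]
    simp [add_assoc, add_comm 1 i]

theorem x_add_mul_inv_pow (p i b : ℕ) :
    x (p + 1 + (i + b)) * (x p ^ b)⁻¹ = (x p ^ b)⁻¹ * x (p + (i + 1)) := by
  rw [eq_inv_mul_iff_mul_eq, ← mul_assoc, mul_inv_eq_iff_eq_mul, x_mul_x_pow (by omega)]
  congr 2
  omega

theorem formVal_mulGen (s : List (ℕ × ℕ)) (p i : ℕ) :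
    formVal p (mulGen s i) = formVal p s * x (p + i) := by
  fun_induction mulGen s i generalizing p with
  | case1 i => simp [formVal_replicate_append, formVal]
  | case2 a s =>
    simp only [formVal, pow_succ, pow_zero, inv_one, mul_one, one_mul, add_zero, mul_assoc]
    rw [formVal_mul_x s (by omega)]
  | case3 a b s => simp [formVal, pow_succ', mul_assoc]
  | case4 a b s i ih =>
    simp only [formVal, ih]
    simp only [mul_assoc, x_add_mul_inv_pow]

theorem formVal_mulInvGen (s : List (ℕ × ℕ)) (p i : ℕ) :
    formVal p (mulInvGen s i) = formVal p s * (x (p + i))⁻¹ := by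
  fun_induction mulInvGen s i generalizing p with
  | case1 i => simp [formVal_replicate_append, formVal]
  | case2 a b s h =>
    simp only [Bool.and_eq_true, Nat.beq_eq, Nat.blt_eq] at h
    obtain ⟨⟨ha, rfl⟩, hs⟩ := h
    obtain ⟨a, rfl⟩ : ∃ k, a = k + 1 := ⟨a - 1, by omega⟩
    match s with
    | [] => simp [formVal, pow_succ]
    | (c, d) :: s =>
      simp only [headBlank, Bool.and_eq_true, Nat.beq_eq] at hs
      obtain ⟨rfl, rfl⟩ := hs
      have := formVal_mul_x s (p := p + 1) (q := p) (by omega)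
      simp only [List.tail_cons, formVal, pow_zero, inv_one, mul_one, one_mul,
        add_zero, Nat.add_sub_cancel, pow_succ, mul_assoc]
      rw [← mul_assoc (x p), ← this, mul_inv_cancel_right]
  | case3 a b s => simp [formVal, pow_succ', mul_assoc]
  | case4 a b s i ih =>
    simp only [formVal, ih, mul_assoc]
    congr 2
    rw [inv_mul_eq_iff_eq_mul, ← mul_assoc, x_add_mul_inv_pow, mul_inv_cancel_right]

theorem formSize_replicate_append (i : ℕ) (s : List (ℕ × ℕ)) :
    formSize (List.replicate i (0, 0) ++ s) = formSize s := by
  induction i with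
  | zero => rfl
  | succ i ih => simpa [List.replicate_succ, formSize_cons] using ih

theorem formSize_le_mulGen (s : List (ℕ × ℕ)) (i : ℕ) :
    formSize s ≤ formSize (mulGen s i) + 1 := by
  fun_induction mulGen s i <;> simp only [formSize_replicate_append, formSize_nil, formSize_cons] <;> omega

theorem formSize_le_mulInvGen (s : List (ℕ × ℕ)) (i : ℕ) :
    formSize s ≤ formSize (mulInvGen s i) + 1 := by
  fun_induction mulInvGen s i with
  | case1 i => simp [formSize_nil]
  | case2 a b s h =>
    simp only [Bool.and_eq_true, Nat.beq_eq, Nat.blt_eq] at h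
    obtain ⟨⟨ha, rfl⟩, hs⟩ := h
    match s with
    | [] => simp only [List.tail_nil, formSize_nil, formSize_cons]; omega
    | (c, d) :: s =>
      simp only [headBlank, Bool.and_eq_true, Nat.beq_eq] at hs
      simp only [List.tail_cons, formSize_cons]
      omega
  | case3 a b s => simp only [formSize_cons]; omega
  | case4 a b s i ih => simp only [formSize_cons]; omega

theorem headBlank_mulGen_succ (s : List (ℕ × ℕ)) (i : ℕ) :
    headBlank (mulGen s (i + 1)) = headBlank s := by
  match s with
  | [] => rfl
  | (a, b) :: s => simp [mulGen, headBlank]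

theorem headBlank_mulInvGen_succ (s : List (ℕ × ℕ)) (i : ℕ) :
    headBlank (mulInvGen s (i + 1)) = headBlank s := by
  match s with
  | [] => rfl
  | (a, b) :: s => simp [mulInvGen, headBlank]

theorem IsReducedForm.replicate_append {s : List (ℕ × ℕ)} (hs : IsReducedForm s) (i : ℕ) :
    IsReducedForm (List.replicate i (0, 0) ++ s) := by
  induction i with
  | zero => exact hs
  | succ i ih => exact ⟨fun h => absurd rfl h, ih⟩

theorem IsReducedForm.mulGen {s : List (ℕ × ℕ)} (hs : IsReducedForm s) (i : ℕ) :
    IsReducedForm (mulGen s i) := by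
  fun_induction _root_.mulGen s i with
  | case1 i => exact .replicate_append (by simp [IsReducedForm]) i
  | case2 a s => exact ⟨by simp, by simp, hs.2⟩
  | case3 a b s => exact ⟨fun ha _ => hs.1 ha (by simp), hs.2⟩
  | case4 a b s i ih =>
    refine ⟨fun ha hb => ?_, ih hs.2⟩
    obtain ⟨b, rfl⟩ := Nat.exists_eq_succ_of_ne_zero hb
    exact (headBlank_mulGen_succ s (i + b)).trans (hs.1 ha hb)

theorem IsReducedForm.mulInvGen {s : List (ℕ × ℕ)} (hs : IsReducedForm s) (i : ℕ) :
    IsReducedForm (mulInvGen s i) := by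
  fun_induction _root_.mulInvGen s i with
  | case1 i => exact .replicate_append (by simp [IsReducedForm]) i
  | case2 a b s =>
    refine ⟨by simp, ?_⟩
    match s with
    | [] => trivial
    | _ :: _ => exact hs.2.2
  | case3 a b s h =>
    refine ⟨fun ha _ => ?_, hs.2⟩
    rcases Nat.eq_zero_or_pos b with rfl | hb
    · simpa [Nat.pos_of_ne_zero ha] using h
    · exact hs.1 ha hb.ne'
  | case4 a b s i ih =>
    refine ⟨fun ha hb => ?_, ih hs.2⟩
    obtain ⟨b, rfl⟩ := Nat.exists_eq_succ_of_ne_zero hb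
    exact (headBlank_mulInvGen_succ s (i + b)).trans (hs.1 ha hb)

theorem plHom_formVal_apply (s : List (ℕ × ℕ)) {p : ℕ} {t : ℚ} (h : t ≤ p) :
    plHom (formVal p s) t = t := by
  induction s generalizing p with
  | nil => simp [formVal]
  | cons e s ih =>
    obtain ⟨a, b⟩ := e
    have hb : (plPerm p ^ b)⁻¹ t = t := by
      rw [Equiv.Perm.inv_eq_iff_eq, plPerm_pow_apply_of_le h]
    simp only [formVal, map_mul, map_pow, map_inv, plHom_x, Equiv.Perm.mul_apply, hb]
    rw [ih (by push_cast; linarith), plPerm_pow_apply_of_le h]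

theorem eq_and_formVal_eq_one {p a b : ℕ} {s : List (ℕ × ℕ)}
    (h : formVal p ((a, b) :: s) = 1) : a = b ∧ formVal (p + 1) s = 1 := by
  rw [formVal, mul_inv_eq_one] at h
  have key := congrArg (fun g => plHom g ((p : ℚ) + 1)) h
  simp only [map_mul, map_pow, plHom_x, Equiv.Perm.mul_apply] at key
  rw [plHom_formVal_apply s (by push_cast; rfl), plPerm_pow_apply, plPerm_pow_apply,
    add_right_inj] at key
  obtain rfl : a = b := pow_right_injective₀ (by norm_num) (by norm_num) key
  exact ⟨rfl, mul_eq_left.mp h⟩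

theorem headBlank_of_formSize_eq_zero {s : List (ℕ × ℕ)} (h : formSize s = 0) :
    headBlank s = true := by
  match s with
  | [] => rfl
  | (a, b) :: s =>
    simp only [formSize_cons] at h
    simp only [headBlank, Bool.and_eq_true, Nat.beq_eq]
    omega

theorem IsReducedForm.formSize_eq_zero {s : List (ℕ × ℕ)} (hs : IsReducedForm s) {p : ℕ}
    (h : formVal p s = 1) : formSize s = 0 := by
  induction s generalizing p with
  | nil => rfl
  | cons e s ih =>
    obtain ⟨a, b⟩ := e
    obtain ⟨rfl, h'⟩ := eq_and_formVal_eq_one h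
    have hz := ih hs.2 h'
    have ha : a = 0 := by
      by_contra ha
      exact Bool.false_ne_true ((hs.1 ha ha).symm.trans (headBlank_of_formSize_eq_zero hz))
    simp [formSize_cons, ha, hz]

/-- The normal forms of the neighbours of an element in the Cayley graph of `F` with respect
to `Xset 2`. -/
def neighborForms (s : List (ℕ × ℕ)) : List (List (ℕ × ℕ)) :=
  [mulGen s 0, mulGen s 1, mulGen s 2, mulInvGen s 0, mulInvGen s 1, mulInvGen s 2]

theorem exists_mem_neighborForms {s : List (ℕ × ℕ)} (hs : IsReducedForm s) {g : ThompsonF}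
    (hg : g ∈ Xset 2 ∨ g⁻¹ ∈ Xset 2) :
    ∃ t ∈ neighborForms s, IsReducedForm t ∧ formVal 0 t = formVal 0 s * g ∧
      formSize s ≤ formSize t + 1 := by
  rcases hg with ⟨i, hi, rfl⟩ | ⟨i, hi, hg⟩
  · refine ⟨mulGen s i, ?_, hs.mulGen i, by simp [formVal_mulGen], formSize_le_mulGen s i⟩
    interval_cases i <;> simp [neighborForms]
  · obtain rfl := inv_eq_iff_eq_inv.mp hg
    refine ⟨mulInvGen s i, ?_, hs.mulInvGen i, by simp [formVal_mulInvGen],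
      formSize_le_mulInvGen s i⟩
    interval_cases i <;> simp [neighborForms]

theorem IsReducedForm.formSize_le_length {s : List (ℕ × ℕ)} (hs : IsReducedForm s)
    {l : List ThompsonF} (hl : ∀ a ∈ l, a ∈ Xset 2 ∨ a⁻¹ ∈ Xset 2)
    (h : formVal 0 s * l.prod = 1) : formSize s ≤ l.length := by
  induction l generalizing s with
  | nil => exact (hs.formSize_eq_zero (by simpa using h)).le
  | cons a l ih =>
    obtain ⟨t, -, ht, hv, hsz⟩ := exists_mem_neighborForms hs (hl a (by simp))
    have := ih ht (fun b hb => hl b (by simp [hb])) (by rw [hv, mul_assoc, ← List.prod_cons, h])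
    rw [List.length_cons]
    omega

/-- Binary search trees of normal forms. -/
inductive FormTree
  | leaf : FormTree
  | node : FormTree → ℕ → List (ℕ × ℕ) → FormTree → FormTree

namespace FormTree

/-- Membership in a tree. -/
def Mem (s : List (ℕ × ℕ)) : FormTree → Prop
  | leaf => False
  | node l _ t r => s = t ∨ Mem s l ∨ Mem s r

/-- Whether a tree is empty. -/
def isLeaf : FormTree → Bool
  | leaf => true
  | node _ _ _ _ => false

/-- Inserts a form into a search tree, without repetition, and passes the result on. -/
def insert (k : ℕ) (s : List (ℕ × ℕ)) : FormTree → (FormTree → Bool) → Bool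
  | leaf, f => f (node leaf k s leaf)
  | node l k' t r, f =>
    bif Nat.blt k k' then insert k s l fun l => f (node l k' t r)
    else bif Nat.blt k' k then insert k s r fun r => f (node l k' t r)
    else bif decide (s = t) then f (node l k' t r)
    else insert k s l fun l => f (node l k' t r)

theorem exists_insert_eq (k : ℕ) (s : List (ℕ × ℕ)) (T : FormTree) :
    ∃ U, (∀ t, t = s ∨ Mem t T → Mem t U) ∧ ∀ f, insert k s T f = f U := by
  induction T with
  | leaf => exact ⟨_, fun t => by simp [Mem], fun f => rfl⟩
  | node l k' u r ihl ihr =>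
    obtain ⟨L, hL, hl⟩ := ihl
    obtain ⟨R, hR, hr⟩ := ihr
    simp only [insert, cond_eq_ite, decide_eq_true_eq, hl, hr]
    split_ifs with h₁ h₂ h₃ <;> refine ⟨_, fun t ht => ?_, fun f => rfl⟩ <;>
      simp only [Mem] at ht ⊢ <;> grind

end FormTree

/-- Evaluates a natural number before passing it on. -/
def withNat {α : Type} (n : ℕ) (f : ℕ → α) : α :=
  n.rec (f 0) fun m _ => f m.succ

theorem withNat_eq {α : Type} (n : ℕ) (f : ℕ → α) : withNat n f = f n := by
  cases n <;> rfl

/-- Evaluates a list of exponents before passing it on. -/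
def withForm {α : Type} (s : List (ℕ × ℕ)) : (List (ℕ × ℕ) → α) → α :=
  s.rec (fun f => f []) fun e _ g f =>
    withNat e.1 fun a => withNat e.2 fun b => g fun s => f ((a, b) :: s)

theorem withForm_eq {α : Type} (s : List (ℕ × ℕ)) (f : List (ℕ × ℕ) → α) :
    withForm s f = f s := by
  induction s generalizing f with
  | nil => rfl
  | cons e s ih =>
    rw [show withForm (e :: s) f = withNat e.1 fun a => withNat e.2 fun b =>
      withForm s fun s => f ((a, b) :: s) from rfl, withNat_eq, withNat_eq, ih]

/-- The key of a normal form in a search tree. -/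
def formKey (s : List (ℕ × ℕ)) : ℕ :=
  s.rec 1 fun e _ n => Nat.add e.1 (Nat.mul 8 (Nat.add e.2 (Nat.mul 8 n)))

/-- Inserts the forms of size at most `n` in the given list into a tree, and passes the result
on. -/
def insertForms (n : ℕ) : List (List (ℕ × ℕ)) → FormTree → (FormTree → Bool) → Bool
  | [], T, f => f T
  | s :: L, T, f =>
    bif Nat.ble (formSize s) n then
      withForm s fun s => withNat (formKey s) fun k => T.insert k s fun T => insertForms n L T f
    else insertForms n L T f

theorem exists_insertForms_eq (n : ℕ) (L : List (List (ℕ × ℕ))) (T : FormTree) :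
    ∃ U : FormTree, (∀ t, t ∈ L ∧ formSize t ≤ n ∨ T.Mem t → U.Mem t) ∧
      ∀ f, insertForms n L T f = f U := by
  induction L generalizing T with
  | nil => exact ⟨T, fun t => by simp, fun f => rfl⟩
  | cons s L ih =>
    simp only [insertForms, withForm_eq, withNat_eq, cond_eq_ite, Nat.ble_eq]
    split_ifs with hn
    · obtain ⟨V, hV, hT⟩ := T.exists_insert_eq (formKey s) s
      obtain ⟨U, hU, hf⟩ := ih V
      refine ⟨U, fun t ht => hU t ?_, fun f => by rw [hT, hf]⟩
      have := hV t
      rw [List.mem_cons] at ht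
      tauto
    · obtain ⟨U, hU, hf⟩ := ih T
      refine ⟨U, fun t ht => hU t ?_, hf⟩
      grind

/-- Adds to a second tree the neighbours of size at most `n` of the members of the first one,
and passes the result on. -/
def addNeighbors (n : ℕ) : FormTree → FormTree → (FormTree → Bool) → Bool
  | .leaf, U, f => f U
  | .node l _ s r, U, f =>
    addNeighbors n l U fun U => insertForms n (neighborForms s) U fun U => addNeighbors n r U f

theorem exists_addNeighbors_eq (n : ℕ) (T U : FormTree) :
    ∃ V : FormTree, (∀ t, (∃ s, T.Mem s ∧ t ∈ neighborForms s ∧ formSize t ≤ n) ∨ U.Mem t →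
      V.Mem t) ∧ ∀ f, addNeighbors n T U f = f V := by
  induction T generalizing U with
  | leaf => exact ⟨U, fun t => by simp [FormTree.Mem], fun f => rfl⟩
  | node l k u r ihl ihr =>
    obtain ⟨V₁, h₁, e₁⟩ := ihl U
    obtain ⟨V₂, h₂, e₂⟩ := exists_insertForms_eq n (neighborForms u) V₁
    obtain ⟨V₃, h₃, e₃⟩ := ihr V₂
    refine ⟨V₃, fun t ht => h₃ t ?_, fun f => by rw [addNeighbors, e₁, e₂, e₃]⟩
    rcases ht with ⟨s, rfl | hs | hs, ht⟩ | h
    · exact .inr (h₂ t (.inl ht))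
    · exact .inr (h₂ t (.inr (h₁ t (.inl ⟨s, hs, ht⟩))))
    · exact .inl ⟨s, hs, ht⟩
    · exact .inr (h₂ t (.inr (h₁ t (.inr h))))

/-- Whether the breadth-first search starting at the members of a tree, which after `k` steps
keeps only the forms of size at most `n - k`, has died out after `m` steps. -/
def searchDies : ℕ → ℕ → FormTree → Bool
  | 0, _, T => T.isLeaf
  | m + 1, n, T => withNat (n - 1) fun n => addNeighbors n T .leaf fun U => searchDies m n U

theorem lt_length_of_searchDies {m n : ℕ} {T : FormTree} (hT : searchDies m n T = true)
    {s : List (ℕ × ℕ)} (hsT : T.Mem s) (hs : IsReducedForm s) {l : List ThompsonF}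
    (hl : ∀ a ∈ l, a ∈ Xset 2 ∨ a⁻¹ ∈ Xset 2) (h : formVal 0 s * l.prod = 1)
    (hm : m ≤ l.length) : n < l.length := by
  induction m generalizing n T s l with
  | zero => cases T <;> simp_all [searchDies, FormTree.isLeaf, FormTree.Mem]
  | succ m ih =>
    match l with
    | [] => simp at hm
    | a :: l =>
      obtain ⟨t, htn, ht, hv, -⟩ := exists_mem_neighborForms hs (hl a (by simp))
      have hl' : ∀ b ∈ l, b ∈ Xset 2 ∨ b⁻¹ ∈ Xset 2 := fun b hb => hl b (by simp [hb])
      have hp : formVal 0 t * l.prod = 1 := by rw [hv, mul_assoc, ← List.prod_cons, h]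
      have hsize := ht.formSize_le_length hl' hp
      rw [List.length_cons] at hm ⊢
      by_contra hn
      obtain ⟨U, hU, hTU⟩ := exists_addNeighbors_eq (n - 1) T .leaf
      rw [searchDies, withNat_eq, hTU] at hT
      have := ih hT (hU t (.inl ⟨s, hsT, htn, by omega⟩)) ht hl' hp (by omega)
      omega

/-- The normal form of the example. -/
def exampleForm : List (ℕ × ℕ) :=
  [(1, 2), (2, 0), (0, 1), (0, 0), (1, 2), (2, 0), (0, 1), (0, 0), (1, 2), (2, 0), (0, 1), (0, 0),
    (1, 2), (2, 0), (0, 1)]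

theorem isReducedForm_exampleForm : IsReducedForm exampleForm := by
  simp [exampleForm, IsReducedForm, headBlank, Nat.beq]

theorem searchDies_exampleForm :
    searchDies 23 27 (.node .leaf 0 exampleForm .leaf) = true := by
  decide +kernel

theorem inv_mem_letters {l : List ThompsonF} (hl : ∀ a ∈ l, a ∈ Xset 2 ∨ a⁻¹ ∈ Xset 2) :
    ∀ a ∈ (l.map (·⁻¹)).reverse, a ∈ Xset 2 ∨ a⁻¹ ∈ Xset 2 := by
  intro a ha
  obtain ⟨b, hb, rfl⟩ := List.mem_map.mp (List.mem_reverse.mp ha)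
  simpa using (hl b hb).symm

theorem ln_two_exampleForm : ln 2 (formVal 0 exampleForm) = 28 := by
  refine IsLeast.csInf_eq ⟨?_, ?_⟩
  · let w : List (ℕ × Bool) := [(0, false), (2, true), (0, false), (2, true), (2, true),
      (1, false), (2, false), (0, true), (2, false), (1, true), (2, true), (2, true), (1, false),
      (2, false), (0, true), (2, false), (1, true), (2, true), (2, true), (1, false), (2, false),
      (0, true), (2, false), (1, true), (1, true), (2, false), (0, false), (0, false)]
    refine ⟨w.map fun e => cond e.2 (x e.1) (x e.1)⁻¹, rfl, ?_, ?_⟩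
    · intro a ha
      obtain ⟨⟨i, e⟩, he, rfl⟩ := List.mem_map.mp ha
      have hi : i ≤ 2 := (by decide : ∀ e ∈ w, e.1 ≤ 2) _ he
      cases e
      · exact .inr ⟨i, hi, by simp⟩
      · exact .inl ⟨i, hi, rfl⟩
    · have hrun (w : List (ℕ × Bool)) (s : List (ℕ × ℕ)) :
          formVal 0 (w.foldl (fun s e => cond e.2 (mulGen s e.1) (mulInvGen s e.1)) s) =
            formVal 0 s * (w.map fun e => cond e.2 (x e.1) (x e.1)⁻¹).prod := by
        induction w generalizing s with
        | nil => simp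
        | cons e w ih =>
          obtain ⟨i, e⟩ := e
          cases e <;> simp [ih, formVal_mulGen, formVal_mulInvGen, mul_assoc]
      have hw : w.foldl (fun s e => cond e.2 (mulGen s e.1) (mulInvGen s e.1)) [] =
          exampleForm := by decide +kernel
      rw [← hw, hrun, formVal, one_mul]
  · rintro _ ⟨l, rfl, hl, hg⟩
    have hp : formVal 0 exampleForm * (l.map (·⁻¹)).reverse.prod = 1 := by
      rw [← List.prod_inv_reverse, hg, mul_inv_cancel]
    have hsize := isReducedForm_exampleForm.formSize_le_length (inv_mem_letters hl) hp
    have := lt_length_of_searchDies searchDies_exampleForm (.inl rfl) isReducedForm_exampleForm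
      (inv_mem_letters hl) hp (le_trans (by decide) hsize)
    simpa [Nat.lt_iff_add_one_le] using this

theorem example_length_28 :
    ln 2 (x 0 * x 1 * x 1 * x 4 * x 5 * x 5 * x 8 * x 9 * x 9 * x 12 * x 13 * x 13 *
      (x 14)⁻¹ * (x 12)⁻¹ * (x 12)⁻¹ * (x 10)⁻¹ * (x 8)⁻¹ * (x 8)⁻¹ * (x 6)⁻¹ *
      (x 4)⁻¹ * (x 4)⁻¹ * (x 2)⁻¹ * (x 0)⁻¹ * (x 0)⁻¹) = 28 := by
  rw [← ln_two_exampleForm]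
  refine congrArg (ln 2) ?_
  simp only [exampleForm, formVal, pow_succ, pow_zero, mul_inv_rev, inv_one, one_mul, mul_one,
    mul_assoc, zero_add, Nat.reduceAdd]
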